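/- arXiv:1502.05383 — 2 statements merged into one kernel-verified Lean document; each statement's English description precedes it below -/
import Mathlib

section
/- Every transformation U of a fuzzy space acts as U(v⊗m) = hv ⊗ gmg* for some unitary g ∈ A and unitary h on V with hγ = γh and hC = Ch; conversely any such pair (g,h) defines a transformation. -/
open Matrix

abbrev Mn (n : ℕ) := Matrix (Fin n) (Fin n) ℂ

lemma fz_inter {n : ℕ} (L : Mn n →ₗ[ℂ] Mn n) (a b : Mn n) (h : ∀ m, L (a * m) = b * L m) (p q : Fin n) :
    (Matrix.of fun r s => L (Matrix.single s q 1) r p : Mn n) * a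
      = b * (Matrix.of fun r s => L (Matrix.single s q 1) r p : Mn n) := by
  ext r t
  have h1 : a * Matrix.single t q (1:ℂ) = ∑ s, a s t • Matrix.single s q (1:ℂ) := by
    ext i j
    simp [Matrix.mul_apply, Matrix.sum_apply, Matrix.single_apply, ite_and, Finset.sum_ite_eq]
  have h2 := congrFun (congrFun (h (Matrix.single t q 1)) r) p
  rw [h1, map_sum] at h2
  simp only [map_smul, Matrix.sum_apply, Matrix.smul_apply, smul_eq_mul, Matrix.mul_apply] at h2
  simp only [Matrix.mul_apply, Matrix.of_apply]
  rw [← h2]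
  exact Finset.sum_congr rfl fun _ _ => mul_comm _ _

lemma fz_expand {n : ℕ} (L : Mn n →ₗ[ℂ] Mn n) (m : Mn n) (r p : Fin n) :
    L m r p = ∑ s, ∑ q, m s q * L (Matrix.single s q 1) r p := by
  conv_lhs => rw [Matrix.matrix_eq_sum_single m]
  simp only [map_sum, Matrix.sum_apply]
  refine Finset.sum_congr rfl fun s _ => Finset.sum_congr rfl fun q _ => ?_
  have : Matrix.single s q (m s q) = m s q • Matrix.single s q (1:ℂ) := by simp
  rw [this, map_smul]; simp

lemma fz_right {n : ℕ} (A : Subalgebra ℝ (Mn n))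
    (hAcomm : ∀ x : Mn n, (∀ a ∈ A, x * a = a * x) → ∃ c : ℂ, x = c • (1 : Mn n))
    (L : Mn n →ₗ[ℂ] Mn n) (hL : ∀ a ∈ A, ∀ m, L (a * m) = a * L m) (m : Mn n) :
    L m = m * L 1 := by
  have h1 : ∀ p q : Fin n, ∃ c : ℂ,
      (Matrix.of fun r s => L (Matrix.single s q 1) r p : Mn n) = c • (1 : Mn n) :=
    fun p q => hAcomm _ fun a ha => fz_inter L a a (hL a ha) p q
  choose c hc using h1
  have h2 : ∀ m : Mn n, L m = m * (Matrix.of fun q p => c p q) := by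
    intro m
    ext r p
    rw [fz_expand, Matrix.mul_apply, Finset.sum_comm]
    refine Finset.sum_congr rfl fun q _ => ?_
    have h3 : ∀ s, L (Matrix.single s q 1) r p = c p q * (if r = s then 1 else 0) := by
      intro s
      have := congrFun (congrFun (hc p q) r) s
      simpa [Matrix.one_apply] using this
    simp [h3]
  rw [h2 m, h2 1, one_mul]

lemma fz_span {n : ℕ} (A : Subalgebra ℝ (Mn n)) (hAstar : ∀ a ∈ A, aᴴ ∈ A)
    (hAcomm : ∀ x : Mn n, (∀ a ∈ A, x * a = a * x) → ∃ c : ℂ, x = c • (1 : Mn n))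
    (m : Mn n) : ∃ x ∈ A, ∃ y ∈ A, m = x + Complex.I • y := by
  let B : Submodule ℂ (Mn n) :=
    { carrier := {m | ∃ x ∈ A, ∃ y ∈ A, m = x + Complex.I • y}
      zero_mem' := ⟨0, A.zero_mem, 0, A.zero_mem, by simp⟩
      add_mem' := by
        rintro _ _ ⟨x, hx, y, hy, rfl⟩ ⟨x', hx', y', hy', rfl⟩
        exact ⟨x + x', A.add_mem hx hx', y + y', A.add_mem hy hy', by rw [smul_add]; abel⟩
      smul_mem' := by
        rintro c _ ⟨x, hx, y, hy, rfl⟩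
        refine ⟨c.re • x - c.im • y, A.sub_mem (A.smul_mem hx _) (A.smul_mem hy _),
          c.im • x + c.re • y, A.add_mem (A.smul_mem hx _) (A.smul_mem hy _), ?_⟩
        ext i j
        simp only [Matrix.smul_apply, Matrix.add_apply, Matrix.sub_apply, smul_eq_mul,
          Complex.real_smul]
        conv_lhs => rw [← Complex.re_add_im c]
        linear_combination (c.im * y i j) * Complex.I_mul_I }
  have hBA : ∀ a ∈ A, ∀ b ∈ B, a * b ∈ B := by
    rintro a ha _ ⟨x, hx, y, hy, rfl⟩
    exact ⟨a * x, A.mul_mem ha hx, a * y, A.mul_mem ha hy, by rw [mul_add, mul_smul_comm]⟩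
  let e : Mn n ≃ₗ[ℂ] EuclideanSpace ℂ (Fin n × Fin n) :=
    (LinearEquiv.curry ℂ ℂ (Fin n) (Fin n)).symm.trans (WithLp.linearEquiv 2 ℂ _).symm
  have he : ∀ x y : Mn n, inner ℂ (e x) (e y) = (xᴴ * y).trace := by
    intro x y
    have h1 : ∀ x i, (e x) i = x i.1 i.2 := fun x i => rfl
    simp only [PiLp.inner_apply, h1, Fintype.sum_prod_type, Matrix.trace, Matrix.diag_apply,
      Matrix.mul_apply, Matrix.conjTranspose_apply, RCLike.inner_apply]
    rw [Finset.sum_comm]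
    refine Finset.sum_congr rfl fun _ _ => Finset.sum_congr rfl fun _ _ => ?_
    rw [mul_comm]; rfl
  let K : Submodule ℂ (EuclideanSpace ℂ (Fin n × Fin n)) := B.map e.toLinearMap
  let P : Mn n →ₗ[ℂ] Mn n := e.symm.toLinearMap ∘ₗ K.starProjection.toLinearMap ∘ₗ e.toLinearMap
  have heP : ∀ m, e (P m) = K.starProjection (e m) := fun m => by simp [P]
  have hmemK : ∀ m, e m ∈ K ↔ m ∈ B := fun m => by simp [K]
  have hPB : ∀ m, P m ∈ B := by
    intro m
    rw [← hmemK, heP]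
    exact Submodule.starProjection_apply_mem _ _
  have hPa : ∀ a ∈ A, ∀ m, P (a * m) = a * P m := by
    intro a ha m
    apply e.injective
    rw [heP]
    apply Submodule.eq_starProjection_of_mem_of_inner_eq_zero
    · exact (hmemK _).2 (hBA a ha _ (hPB m))
    · rintro _ ⟨w, hw, rfl⟩
      have h1 := Submodule.starProjection_inner_eq_zero (K := K) (e m) (e (aᴴ * w))
        ((hmemK _).2 (hBA _ (hAstar a ha) w hw))
      rw [← heP, ← map_sub, he] at h1
      change inner ℂ _ (e w) = 0
      rw [← map_sub, he, ← h1, ← mul_sub, Matrix.conjTranspose_mul, Matrix.mul_assoc]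
  have h1 : P 1 = 1 := by
    apply e.injective
    rw [heP]
    exact Submodule.starProjection_eq_self_iff.2
      ((hmemK _).2 ⟨1, A.one_mem, 0, A.zero_mem, by simp⟩)
  have h2 := fz_right A hAcomm P hPa m
  rw [h1, mul_one] at h2
  have := hPB m
  rw [h2] at this
  exact this

lemma fz_real {n : ℕ} (A : Subalgebra ℝ (Mn n)) (hAstar : ∀ a ∈ A, aᴴ ∈ A)
    (hAsimple : ∀ I : TwoSidedIdeal A, I = ⊥ ∨ I = ⊤)
    (hAcomm : ∀ x : Mn n, (∀ a ∈ A, x * a = a * x) → ∃ c : ℂ, x = c • (1 : Mn n))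
    (f : Mn n → Mn n) (hfA : ∀ a ∈ A, f a ∈ A)
    (g : Mn n) (hg0 : g ≠ 0) (hg : ∀ a ∈ A, g * a = f a * g) :
    ∃ x ∈ A, x ≠ 0 ∧ ∀ a ∈ A, x * a = f a * x := by
  obtain ⟨x, hx, y, hy, hxy⟩ := fz_span A hAstar hAcomm g
  let J : TwoSidedIdeal A := TwoSidedIdeal.mk' {a : A | Complex.I • (a : Mn n) ∈ A}
    (by simp)
    (by
      intro a b ha hb
      have := A.add_mem ha hb
      simpa [smul_add] using this)
    (by
      intro a ha
      have := A.neg_mem ha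
      simpa using this)
    (by
      intro a b hb
      have := A.mul_mem a.2 hb
      simpa using this)
    (by
      intro a b ha
      have := A.mul_mem ha b.2
      simpa using this)
  have hJ : ∀ a : A, a ∈ J ↔ Complex.I • (a : Mn n) ∈ A := fun a => by
    simp only [J, TwoSidedIdeal.mem_mk', Set.mem_ofPred_eq]
  rcases hAsimple J with h | h
  · have key : ∀ d ∈ A, Complex.I • d ∈ A → d = 0 := by
      intro d hd h1
      have : (⟨d, hd⟩ : A) ∈ J := (hJ _).2 h1
      rw [h, TwoSidedIdeal.mem_bot] at this
      exact congrArg Subtype.val this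
    have key2 : ∀ a ∈ A, x * a = f a * x ∧ y * a = f a * y := by
      intro a ha
      have h1 := hg a ha
      rw [hxy, add_mul, mul_add, smul_mul_assoc, mul_smul_comm] at h1
      have hd1 : x * a - f a * x ∈ A :=
        A.sub_mem (A.mul_mem hx ha) (A.mul_mem (hfA a ha) hx)
      have hd2 : y * a - f a * y ∈ A :=
        A.sub_mem (A.mul_mem hy ha) (A.mul_mem (hfA a ha) hy)
      have h2 : Complex.I • (y * a - f a * y) = -(x * a - f a * x) := by
        rw [smul_sub, neg_sub, sub_eq_sub_iff_add_eq_add, add_comm, h1]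
      have h3 := key _ hd2 (h2 ▸ A.neg_mem hd1)
      rw [h3, smul_zero] at h2
      exact ⟨sub_eq_zero.1 (neg_eq_zero.1 h2.symm), sub_eq_zero.1 h3⟩
    by_cases hx0 : x = 0
    · refine ⟨y, hy, ?_, fun a ha => (key2 a ha).2⟩
      rintro rfl
      exact hg0 (by simp [hxy, hx0])
    · exact ⟨x, hx, hx0, fun a ha => (key2 a ha).1⟩
  · have h1 : (⟨y, hy⟩ : A) ∈ J := h ▸ TwoSidedIdeal.mem_top A
    exact ⟨g, hxy ▸ A.add_mem hx ((hJ _).1 h1), hg0, hg⟩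

open scoped ComplexOrder in
lemma fz_unitary {n : ℕ} (A : Subalgebra ℝ (Mn n)) (hAstar : ∀ a ∈ A, aᴴ ∈ A)
    (hAcomm : ∀ x : Mn n, (∀ a ∈ A, x * a = a * x) → ∃ c : ℂ, x = c • (1 : Mn n))
    (f : Mn n → Mn n) (hfs : ∀ a ∈ A, f aᴴ = (f a)ᴴ)
    (x : Mn n) (hxA : x ∈ A) (hx0 : x ≠ 0) (hx : ∀ a ∈ A, x * a = f a * x) :
    ∃ g ∈ A, gᴴ * g = 1 ∧ g * gᴴ = 1 ∧ ∀ a ∈ A, g * a = f a * g := by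
  have h1 : ∀ a ∈ A, (xᴴ * x) * a = a * (xᴴ * x) := by
    intro a ha
    have h2 := congrArg Matrix.conjTranspose (hx _ (hAstar a ha))
    rw [hfs a ha] at h2
    simp only [Matrix.conjTranspose_mul, Matrix.conjTranspose_conjTranspose] at h2
    rw [Matrix.mul_assoc, hx a ha, ← Matrix.mul_assoc, ← h2, Matrix.mul_assoc]
  obtain ⟨c, hc⟩ := hAcomm _ h1
  have hn : ∃ i : Fin n, True := by
    by_contra hne
    push Not at hne
    apply hx0
    ext i j
    exact (hne i).elim
  obtain ⟨i0, -⟩ := hn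
  have hps := (Matrix.posSemidef_conjTranspose_mul_self x)
  have hc0 : 0 ≤ c := by
    have := hps.diag_nonneg (i := i0)
    rw [hc] at this
    simpa using this
  have hcne : c ≠ 0 := by
    rintro rfl
    apply hx0
    rw [zero_smul] at hc
    exact Matrix.conjTranspose_mul_self_eq_zero.1 hc
  obtain ⟨hre, him⟩ := Complex.nonneg_iff.1 hc0
  have hcr : c = (c.re : ℂ) := by
    apply Complex.ext <;> simp [← him]
  have hrne : c.re ≠ 0 := fun h => hcne (by rw [hcr, h]; simp)
  have hu : ((Real.sqrt c.re)⁻¹ • x)ᴴ * ((Real.sqrt c.re)⁻¹ • x) = 1 := by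
    rw [Matrix.conjTranspose_smul, smul_mul_smul_comm, hc, hcr]
    ext i j
    simp only [Matrix.smul_apply, star_trivial, Complex.real_smul, smul_eq_mul, Complex.ofReal_re]
    rw [← mul_assoc, ← Complex.ofReal_mul, ← mul_inv, Real.mul_self_sqrt hre,
      inv_mul_cancel₀ hrne]
    simp
  refine ⟨(Real.sqrt c.re)⁻¹ • x, A.smul_mem hxA _, hu, mul_eq_one_comm.1 hu, ?_⟩
  intro a ha
  rw [smul_mul_assoc, mul_smul_comm, hx a ha]

/-- action of a matrix on families -/
def fzAct {k n : ℕ} (h : Matrix (Fin k) (Fin k) ℂ) (ψ : Fin k → Mn n) : Fin k → Mn n :=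
  fun i => ∑ j, h i j • ψ j

lemma fzAct_mul {k n : ℕ} (h h' : Matrix (Fin k) (Fin k) ℂ) (ψ : Fin k → Mn n) :
    fzAct (h * h') ψ = fzAct h (fzAct h' ψ) := by
  funext i
  simp only [fzAct, Matrix.mul_apply, Finset.sum_smul, Finset.smul_sum, smul_smul]
  exact Finset.sum_comm

lemma fzAct_one {k n : ℕ} (ψ : Fin k → Mn n) : fzAct 1 ψ = ψ := by
  funext i
  simp [fzAct, Matrix.one_apply, ite_smul]

lemma fzAct_lr {k n : ℕ} (h : Matrix (Fin k) (Fin k) ℂ) (a b : Mn n) (ψ : Fin k → Mn n) (i) :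
    a * fzAct h ψ i * b = fzAct h (fun j => a * ψ j * b) i := by
  simp only [fzAct, Finset.mul_sum, Finset.sum_mul, mul_smul_comm, smul_mul_assoc]

lemma fzAct_star {k n : ℕ} (h : Matrix (Fin k) (Fin k) ℂ) (ψ : Fin k → Mn n) (i) :
    (fzAct h ψ i)ᴴ = fzAct (h.map (starRingEnd ℂ)) (fun j => (ψ j)ᴴ) i := by
  simp [fzAct, Matrix.conjTranspose_sum, Matrix.conjTranspose_smul]

lemma fzAct_inner {k n : ℕ} (h : Matrix (Fin k) (Fin k) ℂ) (hh : hᴴ * h = 1)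
    (ψ φ : Fin k → Mn n) :
    ∑ i, ((fzAct h ψ i)ᴴ * fzAct h φ i).trace = ∑ i, ((ψ i)ᴴ * φ i).trace := by
  have h1 : ∀ p q, ∑ i, star (h i p) * h i q = if p = q then 1 else 0 := by
    intro p q
    have := congrFun (congrFun hh p) q
    simpa [Matrix.mul_apply, Matrix.one_apply] using this
  have h2 : ∀ i, ((fzAct h ψ i)ᴴ * fzAct h φ i).trace
      = ∑ p, ∑ q, (star (h i p) * h i q) * ((ψ p)ᴴ * φ q).trace := by
    intro i
    simp only [fzAct, Matrix.conjTranspose_sum, Matrix.conjTranspose_smul, Finset.sum_mul,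
      Finset.mul_sum, Matrix.trace_sum, smul_mul_smul_comm, Matrix.trace_smul, smul_eq_mul]
    exact Finset.sum_comm
  simp only [h2]
  rw [Finset.sum_comm]
  refine Finset.sum_congr rfl fun p _ => ?_
  rw [Finset.sum_comm]
  simp only [← Finset.sum_mul, h1]
  simp

lemma fz_converse (n k : ℕ)
    (A : Subalgebra ℝ (Mn n)) (hAstar : ∀ a ∈ A, aᴴ ∈ A)
    (γ Kc : Matrix (Fin k) (Fin k) ℂ) 
    (g : Matrix (Fin n) (Fin n) ℂ) (hgA : g ∈ A) (hg1 : gᴴ * g = 1) (hg2 : g * gᴴ = 1)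
    (h : Matrix (Fin k) (Fin k) ℂ) (hh1 : hᴴ * h = 1) (hh2 : h * hᴴ = 1) (hγ : h * γ = γ * h)
    (hK : h * Kc = Kc * h.map (starRingEnd ℂ)) :
          (Function.Bijective
              (fun ψ : Fin k → Matrix (Fin n) (Fin n) ℂ => fzAct h (fun j => g * ψ j * gᴴ)))
          ∧ (∀ ψ φ : Fin k → Matrix (Fin n) (Fin n) ℂ,
              ∑ i, ((fzAct h (fun j => g * ψ j * gᴴ) i)ᴴ
                  * (fzAct h (fun j => g * φ j * gᴴ) i)).trace
                = ∑ i, ((ψ i)ᴴ * φ i).trace)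
          ∧ (∀ a ∈ A, ∃ b ∈ A, ∀ ψ : Fin k → Matrix (Fin n) (Fin n) ℂ,
              fzAct h (fun j => g * (a * ψ j) * gᴴ)
                = fun i => b * (fzAct h (fun j => g * ψ j * gᴴ) i))
          ∧ (∀ ψ : Fin k → Matrix (Fin n) (Fin n) ℂ,
              fzAct h (fun j => g * fzAct γ ψ j * gᴴ)
                = fzAct γ (fzAct h (fun j => g * ψ j * gᴴ)))
          ∧ (∀ ψ : Fin k → Matrix (Fin n) (Fin n) ℂ,
              fzAct h (fun j => g * fzAct Kc (fun j' => (ψ j')ᴴ) j * gᴴ)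
                = fzAct Kc (fun j => (fzAct h (fun j' => g * ψ j' * gᴴ) j)ᴴ)) := by
  have c1 : ∀ m : Mn n, gᴴ * (g * m * gᴴ) * g = m := by
    intro m
    calc gᴴ * (g * m * gᴴ) * g = (gᴴ * g) * m * (gᴴ * g) := by simp only [Matrix.mul_assoc]
      _ = m := by rw [hg1]; simp
  have c2 : ∀ m : Mn n, g * (gᴴ * m * g) * gᴴ = m := by
    intro m
    calc g * (gᴴ * m * g) * gᴴ = (g * gᴴ) * m * (g * gᴴ) := by simp only [Matrix.mul_assoc]
      _ = m := by rw [hg2]; simp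
  refine ⟨?_, ?_, ?_, ?_, ?_⟩
  · refine Function.bijective_iff_has_inverse.2
      ⟨fun ψ => fzAct hᴴ (fun j => gᴴ * ψ j * g), ?_, ?_⟩
    · intro ψ
      dsimp only
      simp only [fzAct_lr]
      simp only [c1]
      rw [← fzAct_mul, hh1, fzAct_one]
    · intro ψ
      dsimp only
      simp only [fzAct_lr]
      simp only [c2]
      rw [← fzAct_mul, hh2, fzAct_one]
  · intro ψ φ
    rw [fzAct_inner h hh1]
    refine Finset.sum_congr rfl fun i _ => ?_
    have : (g * ψ i * gᴴ)ᴴ * (g * φ i * gᴴ) = g * ((ψ i)ᴴ * φ i * gᴴ) := by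
      simp only [Matrix.conjTranspose_mul, Matrix.conjTranspose_conjTranspose]
      calc g * ((ψ i)ᴴ * gᴴ) * (g * φ i * gᴴ) = g * (ψ i)ᴴ * (gᴴ * g) * φ i * gᴴ := by
            simp only [Matrix.mul_assoc]
        _ = _ := by rw [hg1]; simp only [Matrix.mul_assoc, Matrix.one_mul, Matrix.mul_one]
    rw [this, Matrix.trace_mul_comm, Matrix.mul_assoc, hg1, Matrix.mul_one]
  · intro a ha
    refine ⟨g * a * gᴴ, A.mul_mem (A.mul_mem hgA ha) (hAstar g hgA), fun ψ => ?_⟩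
    funext i
    have := fzAct_lr h (g * a * gᴴ) 1 (fun j => g * ψ j * gᴴ) i
    rw [mul_one] at this
    rw [this]
    congr 1
    funext j
    symm
    calc g * a * gᴴ * (g * ψ j * gᴴ) * 1 = g * a * (gᴴ * g) * ψ j * gᴴ := by
          simp only [Matrix.mul_assoc, Matrix.mul_one]
      _ = g * (a * ψ j) * gᴴ := by
          rw [hg1]
          simp only [Matrix.mul_assoc, Matrix.one_mul]
  · intro ψ
    simp only [fzAct_lr]
    change fzAct h (fzAct γ _) = _
    rw [← fzAct_mul, ← fzAct_mul, hγ]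
  · intro ψ
    simp only [fzAct_lr, fzAct_star]
    change fzAct h (fzAct Kc _) = fzAct Kc (fzAct _ _)
    rw [← fzAct_mul, ← fzAct_mul, hK]
    simp only [Matrix.conjTranspose_mul, Matrix.conjTranspose_conjTranspose, Matrix.mul_assoc]

open scoped ComplexOrder in
set_option maxHeartbeats 1000000 in
lemma fz_forward (n k : ℕ) (hn : 0 < n) (hk : 0 < k)
    (A : Subalgebra ℝ (Mn n)) (hAstar : ∀ a ∈ A, aᴴ ∈ A)
    (hAsimple : ∀ I : TwoSidedIdeal A, I = ⊥ ∨ I = ⊤)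
    (hAcomm : ∀ x : Mn n, (∀ a ∈ A, x * a = a * x) → ∃ c : ℂ, x = c • (1 : Mn n))
    (γ Kc : Matrix (Fin k) (Fin k) ℂ)
    (hKc2 : Kc * Kcᴴ = 1)
    (U : (Fin k → Mn n) →ₗ[ℂ] (Fin k → Mn n)) (hU : Function.Bijective U)
    (hUu : ∀ ψ φ : Fin k → Mn n,
        ∑ i, ((U ψ i)ᴴ * U φ i).trace = ∑ i, ((ψ i)ᴴ * φ i).trace)
    (hUA : ∀ a ∈ A, ∃ b ∈ A, ∀ ψ, U (fun i => a * ψ i) = fun i => b * U ψ i)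
    (hUγ : ∀ ψ, U (fzAct γ ψ) = fzAct γ (U ψ))
    (hUJ : ∀ ψ, U (fzAct Kc (fun j => (ψ j)ᴴ)) = fzAct Kc (fun j => (U ψ j)ᴴ)) :
    ∃ g : Mn n, g ∈ A ∧ gᴴ * g = 1 ∧ g * gᴴ = 1 ∧
        ∃ h : Matrix (Fin k) (Fin k) ℂ,
          hᴴ * h = 1 ∧ h * hᴴ = 1 ∧ h * γ = γ * h ∧
          h * Kc = Kc * h.map (starRingEnd ℂ) ∧
          ∀ ψ, U ψ = fzAct h (fun j => g * ψ j * gᴴ) := by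
  let i0 : Fin k := ⟨0, hk⟩
  let r0 : Fin n := ⟨0, hn⟩
  have hf : ∀ a : Mn n, ∃ b : Mn n, a ∈ A → b ∈ A ∧ ∀ ψ, U (fun i => a * ψ i) = fun i => b * U ψ i := by
    intro a
    by_cases ha : a ∈ A
    · obtain ⟨b, hb, h⟩ := hUA a ha
      exact ⟨b, fun _ => ⟨hb, h⟩⟩
    · exact ⟨0, fun h => (ha h).elim⟩
  choose f hf using hf
  have hfs : ∀ a ∈ A, f aᴴ = (f a)ᴴ := by
    intro a ha
    have h1 : ∀ ψ χ : Fin k → Mn n, ∑ i, ((ψ i)ᴴ * (((f aᴴ)ᴴ - f a) * χ i)).trace = 0 := by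
      intro ψ χ
      obtain ⟨ψ, rfl⟩ := hU.2 ψ
      obtain ⟨χ, rfl⟩ := hU.2 χ
      have e1 := hUu ψ (fun i => a * χ i)
      have e2 := hUu (fun i => aᴴ * ψ i) χ
      rw [(hf a ha).2] at e1
      rw [(hf _ (hAstar a ha)).2] at e2
      simp only [Matrix.conjTranspose_mul, Matrix.conjTranspose_conjTranspose,
        Matrix.mul_assoc] at e1 e2
      simp only [sub_mul, mul_sub, Matrix.trace_sub, Finset.sum_sub_distrib]
      rw [e1, e2, sub_self]
    have h2 := h1 (Pi.single i0 ((f aᴴ)ᴴ - f a)) (fun _ => 1)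
    rw [Finset.sum_eq_single i0 (by intro b _ hb; simp [hb]) (by simp)] at h2
    simp only [Pi.single_eq_same, mul_one] at h2
    have h3 := sub_eq_zero.1 (Matrix.trace_conjTranspose_mul_self_eq_zero_iff.1 h2)
    rw [← h3, Matrix.conjTranspose_conjTranspose]
  -- components
  let Uc : Fin k → Fin k → (Mn n →ₗ[ℂ] Mn n) := fun i j =>
    LinearMap.proj i ∘ₗ U ∘ₗ LinearMap.single ℂ (fun _ : Fin k => Mn n) j
  have hUc : ∀ ψ i, U ψ i = ∑ j, Uc i j (ψ j) := by
    intro ψ i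
    have : ψ = ∑ j, Pi.single j (ψ j) := (Finset.univ_sum_single ψ).symm
    conv_lhs => rw [this, map_sum, Finset.sum_apply]
    rfl
  have hsingle : ∀ (a m : Mn n) (j : Fin k),
      (Pi.single j (a * m) : Fin k → Mn n) = fun i => a * (Pi.single j m : Fin k → Mn n) i := by
    intro a m j
    funext i
    by_cases h : i = j
    · subst h; simp
    · simp [h]
  have hsingle' : ∀ (a m : Mn n) (j : Fin k),
      (Pi.single j (m * a) : Fin k → Mn n) = fun i => (Pi.single j m : Fin k → Mn n) i * a := by
    intro a m j
    funext i
    by_cases h : i = j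
    · subst h; simp
    · simp [h]
  have hUca : ∀ a ∈ A, ∀ i j m, Uc i j (a * m) = f a * Uc i j m := by
    intro a ha i j m
    change U (Pi.single j (a * m)) i = f a * U (Pi.single j m) i
    rw [hsingle, (hf a ha).2]
  have hUright : ∀ a ∈ A, ∀ ψ, U (fun i => ψ i * a) = fun i => U ψ i * f a := by
    intro a ha ψ
    let χ : Fin k → Mn n := fun j => (fzAct Kcᴴ ψ j)ᴴ
    have hχ : fzAct Kc (fun j => (χ j)ᴴ) = ψ := by
      simp only [χ, Matrix.conjTranspose_conjTranspose]
      change fzAct Kc (fzAct Kcᴴ ψ) = ψ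
      rw [← fzAct_mul, hKc2, fzAct_one]
    have hr : ∀ (b : Mn n) (ξ : Fin k → Mn n), fzAct Kc (fun j => (b * ξ j)ᴴ)
        = fun i => fzAct Kc (fun j => (ξ j)ᴴ) i * bᴴ := by
      intro b ξ
      funext i
      have := fzAct_lr Kc 1 bᴴ (fun j => (ξ j)ᴴ) i
      rw [one_mul] at this
      rw [this]
      simp only [Matrix.conjTranspose_mul, one_mul]
    have h1 := hUJ (fun i => aᴴ * χ i)
    rw [(hf _ (hAstar a ha)).2, hr, hr, ← hUJ, hχ, Matrix.conjTranspose_conjTranspose, hfs a ha,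
      Matrix.conjTranspose_conjTranspose] at h1
    exact h1
  have hUcr : ∀ a ∈ A, ∀ i j m, Uc i j (m * a) = Uc i j m * f a := by
    intro a ha i j m
    change U (Pi.single j (m * a)) i = U (Pi.single j m) i * f a
    rw [hsingle', hUright a ha]
  -- an intertwiner
  have hex : ∃ g : Mn n, g ≠ 0 ∧ ∀ a ∈ A, g * a = f a * g := by
    by_contra hne
    push Not at hne
    have hz : ∀ i j m, Uc i j m = 0 := by
      intro i j m
      ext r p
      rw [fz_expand]
      refine Finset.sum_eq_zero fun s _ => Finset.sum_eq_zero fun q _ => ?_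
      by_contra h
      have h0 : (Matrix.of fun r s => Uc i j (Matrix.single s q 1) r p : Mn n) ≠ 0 := by
        intro h0
        have := congrFun (congrFun h0 r) s
        simp only [Matrix.of_apply, Matrix.zero_apply] at this
        exact h (by rw [this, mul_zero])
      obtain ⟨a, ha, hh⟩ := hne _ h0
      exact hh (fz_inter (Uc i j) a (f a) (hUca a ha i j) p q)
    obtain ⟨ψ, hψ⟩ := hU.2 (fun _ => 1)
    have h1 := congrFun hψ i0
    rw [hUc] at h1
    simp only [hz, Finset.sum_const_zero] at h1
    have := congrFun (congrFun h1 r0) r0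
    simp at this
  obtain ⟨g0, hg00, hg0⟩ := hex
  obtain ⟨x, hxA, hx0, hx⟩ := fz_real A hAstar hAsimple hAcomm f (fun a ha => (hf a ha).1) g0 hg00 hg0
  obtain ⟨g, hgA, hg1, hg2, hg⟩ := fz_unitary A hAstar hAcomm f hfs x hxA hx0 hx
  have hfg : ∀ a ∈ A, gᴴ * f a = a * gᴴ := by
    intro a ha
    calc gᴴ * f a = gᴴ * (f a * g) * gᴴ := by
          rw [Matrix.mul_assoc, Matrix.mul_assoc, hg2, Matrix.mul_one]
      _ = (gᴴ * g) * a * gᴴ := by rw [← hg a ha]; simp only [Matrix.mul_assoc, Matrix.one_mul, Matrix.mul_one]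
      _ = a * gᴴ := by rw [hg1, Matrix.one_mul]
  let W : Fin k → Fin k → (Mn n →ₗ[ℂ] Mn n) := fun i j =>
    LinearMap.mulRight ℂ g ∘ₗ LinearMap.mulLeft ℂ gᴴ ∘ₗ Uc i j
  have hW : ∀ i j m, W i j m = gᴴ * Uc i j m * g := fun i j m => rfl
  have hWl : ∀ i j, ∀ a ∈ A, ∀ m, W i j (a * m) = a * W i j m := by
    intro i j a ha m
    rw [hW, hW, hUca a ha, ← Matrix.mul_assoc, hfg a ha]
    simp only [Matrix.mul_assoc]
  have hWr : ∀ i j, ∀ a ∈ A, ∀ m, W i j (m * a) = W i j m * a := by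
    intro i j a ha m
    rw [hW, hW, hUcr a ha, Matrix.mul_assoc, Matrix.mul_assoc, ← hg a ha]
    simp only [Matrix.mul_assoc]
  have hsc : ∀ i j, ∃ c : ℂ, W i j 1 = c • (1 : Mn n) := by
    intro i j
    refine hAcomm _ fun a ha => ?_
    rw [← hWr i j a ha, ← hWl i j a ha, one_mul, mul_one]
  obtain ⟨h, hh⟩ : ∃ h : Matrix (Fin k) (Fin k) ℂ, ∀ i j, W i j 1 = h i j • (1 : Mn n) := by
    choose h hh using hsc
    exact ⟨Matrix.of h, hh⟩
  have hUcf : ∀ i j m, Uc i j m = h i j • (g * m * gᴴ) := by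
    intro i j m
    have h1 := fz_right A hAcomm (W i j) (hWl i j) m
    rw [hh, hW] at h1
    calc Uc i j m = (g * gᴴ) * Uc i j m * (g * gᴴ) := by rw [hg2]; simp
      _ = g * (gᴴ * Uc i j m * g) * gᴴ := by simp only [Matrix.mul_assoc]
      _ = _ := by rw [h1]; simp
  have hform : ∀ ψ, U ψ = fzAct h (fun j => g * ψ j * gᴴ) := by
    intro ψ
    funext i
    rw [hUc]
    simp only [hUcf]
    rfl
  -- injectivity of the scalar action
  have hδ : ∀ (p : Fin k), U (Pi.single p 1) = fzAct h (Pi.single p 1) := by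
    intro p
    rw [hform]
    congr 1
    funext j
    by_cases hj : j = p
    · subst hj; simp [hg2]
    · simp [hj]
  have hδv : ∀ (t : Matrix (Fin k) (Fin k) ℂ) (p i : Fin k),
      fzAct t (Pi.single p (1 : Mn n)) i = t i p • (1 : Mn n) := by
    intro t p i
    simp only [fzAct]
    rw [Finset.sum_eq_single p (by intro b _ hb; simp [hb]) (by simp)]
    simp
  have hinj : ∀ t t' : Matrix (Fin k) (Fin k) ℂ,
      (∀ p, fzAct t (Pi.single p (1 : Mn n)) = fzAct t' (Pi.single p (1 : Mn n))) → t = t' := by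
    intro t t' H
    ext i p
    have h1 := congrFun (H p) i
    rw [hδv, hδv] at h1
    have := congrFun (congrFun h1 r0) r0
    simpa using this
  have hscal : ∀ t : Matrix (Fin k) (Fin k) ℂ, ∀ p, 
      U (fzAct t (Pi.single p 1)) = fzAct h (fzAct t (Pi.single p 1)) := by
    intro t p
    rw [hform]
    congr 1
    funext j
    rw [hδv]
    simp [hg2]
  have hh1 : hᴴ * h = 1 := by
    ext p q
    have h1 := hUu (Pi.single p 1) (Pi.single q 1)
    rw [hδ, hδ] at h1
    simp only [hδv, Matrix.conjTranspose_smul, Matrix.conjTranspose_one, smul_mul_smul_comm,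
      mul_one, Matrix.trace_smul, smul_eq_mul, Matrix.trace_one, Fintype.card_fin,
      ← Finset.sum_mul] at h1
    have hn0 : (n : ℂ) ≠ 0 := by exact_mod_cast hn.ne'
    have h2 : ∑ i, ((Pi.single p (1 : Mn n) : Fin k → Mn n) i)ᴴ
        * (Pi.single q (1 : Mn n) : Fin k → Mn n) i = (1 : Matrix (Fin k) (Fin k) ℂ) p q • (1 : Mn n) := by
      rw [Finset.sum_eq_single p (by intro b _ hb; simp [hb]) (by simp)]
      by_cases hpq : p = q
      · subst hpq; simp
      · simp [hpq]
    rw [← Matrix.trace_sum, h2, Matrix.trace_smul, Matrix.trace_one, Fintype.card_fin,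
      smul_eq_mul] at h1
    have h3 := mul_right_cancel₀ hn0 h1
    rw [← h3]
    simp [Matrix.mul_apply]
  refine ⟨g, hgA, hg1, hg2, h, hh1, mul_eq_one_comm.1 hh1, ?_, ?_, hform⟩
  · apply hinj
    intro p
    rw [fzAct_mul, fzAct_mul]
    rw [← hscal, ← hδ, hUγ]
  · apply hinj
    intro p
    rw [fzAct_mul, fzAct_mul]
    have h1 : (fun j => ((Pi.single p (1 : Mn n) : Fin k → Mn n) j)ᴴ) = Pi.single p (1 : Mn n) := by
      funext j
      by_cases hj : j = p
      · subst hj; simp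
      · simp [hj]
    have h2 := hUJ (Pi.single p 1)
    rw [h1, hscal, hδ] at h2
    rw [h2]
    congr 1
    funext j
    rw [fzAct_star, h1]

/-- Every transformation U of a fuzzy space (a unitary on
H = V ⊗ M(n,ℂ) commuting with Γ and J and normalising ρ(A)) acts as
U(v⊗m) = hv ⊗ gmg* for some unitary g ∈ A and unitary h on V commuting with γ
and C; conversely any such pair (g,h) defines a transformation.  Here
H = V ⊗ M(n,ℂ) is encoded as V-indexed families ψ : Fin k → M(n,ℂ), the
chirality on V is the matrix γ and the antilinear C is v ↦ Kc (star v).  The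
simple algebra A is a star-closed simple real subalgebra of M(n,ℂ) whose
commutant consists of scalars. -/
theorem fuzzy_space_transformations
    (n k : ℕ)
    (A : Subalgebra ℝ (Matrix (Fin n) (Fin n) ℂ))
    (hAstar : ∀ a ∈ A, aᴴ ∈ A)
    (hAsimple : ∀ I : TwoSidedIdeal A, I = ⊥ ∨ I = ⊤)
    (hAcomm : ∀ x : Matrix (Fin n) (Fin n) ℂ,
      (∀ a ∈ A, x * a = a * x) → ∃ c : ℂ, x = c • (1 : Matrix (Fin n) (Fin n) ℂ))
    (γ Kc : Matrix (Fin k) (Fin k) ℂ) (ε : ℂ) (hε : ε = 1 ∨ ε = -1)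
    (hγsa : γᴴ = γ) (hγ2 : γ * γ = 1)
    (hKc1 : Kcᴴ * Kc = 1) (hKc2 : Kc * Kcᴴ = 1)
    (hC2 : Kc * Kc.map (starRingEnd ℂ) = ε • (1 : Matrix (Fin k) (Fin k) ℂ)) :
    -- every transformation has the stated form
    (∀ U : (Fin k → Matrix (Fin n) (Fin n) ℂ) →ₗ[ℂ] (Fin k → Matrix (Fin n) (Fin n) ℂ),
      Function.Bijective U →
      -- U is unitary
      (∀ ψ φ : Fin k → Matrix (Fin n) (Fin n) ℂ,
        ∑ i, ((U ψ i)ᴴ * U φ i).trace = ∑ i, ((ψ i)ᴴ * φ i).trace) →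
      -- U normalises the left action of A
      (∀ a ∈ A, ∃ b ∈ A, ∀ ψ, U (fun i => a * ψ i) = fun i => b * U ψ i) →
      -- UΓ = ΓU
      (∀ ψ, U (fun i => ∑ j, γ i j • ψ j) = fun i => ∑ j, γ i j • U ψ j) →
      -- UJ = JU
      (∀ ψ, U (fun i => ∑ j, Kc i j • (ψ j)ᴴ) = fun i => ∑ j, Kc i j • (U ψ j)ᴴ) →
      ∃ g : Matrix (Fin n) (Fin n) ℂ, g ∈ A ∧ gᴴ * g = 1 ∧ g * gᴴ = 1 ∧
        ∃ h : Matrix (Fin k) (Fin k) ℂ,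
          hᴴ * h = 1 ∧ h * hᴴ = 1 ∧ h * γ = γ * h ∧
          h * Kc = Kc * h.map (starRingEnd ℂ) ∧
          ∀ ψ, U ψ = fun i => ∑ j, h i j • (g * ψ j * gᴴ))
    -- conversely, any such pair (g,h) defines a transformation
    ∧ (∀ g : Matrix (Fin n) (Fin n) ℂ, g ∈ A → gᴴ * g = 1 → g * gᴴ = 1 →
        ∀ h : Matrix (Fin k) (Fin k) ℂ,
          hᴴ * h = 1 → h * hᴴ = 1 → h * γ = γ * h →
          h * Kc = Kc * h.map (starRingEnd ℂ) →
          (Function.Bijective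
              (fun ψ : Fin k → Matrix (Fin n) (Fin n) ℂ =>
                fun i => ∑ j, h i j • (g * ψ j * gᴴ)))
          ∧ (∀ ψ φ : Fin k → Matrix (Fin n) (Fin n) ℂ,
              ∑ i, (((∑ j, h i j • (g * ψ j * gᴴ)) : Matrix (Fin n) (Fin n) ℂ)ᴴ
                  * (∑ j, h i j • (g * φ j * gᴴ))).trace
                = ∑ i, ((ψ i)ᴴ * φ i).trace)
          ∧ (∀ a ∈ A, ∃ b ∈ A, ∀ ψ : Fin k → Matrix (Fin n) (Fin n) ℂ,
              (fun i => ∑ j, h i j • (g * (a * ψ j) * gᴴ))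
                = fun i => b * (∑ j, h i j • (g * ψ j * gᴴ)))
          ∧ (∀ ψ : Fin k → Matrix (Fin n) (Fin n) ℂ,
              (fun i => ∑ j, h i j • (g * ((∑ j', γ j j' • ψ j') : Matrix (Fin n) (Fin n) ℂ) * gᴴ))
                = fun i => ∑ j, γ i j • (∑ j', h j j' • (g * ψ j' * gᴴ)))
          ∧ (∀ ψ : Fin k → Matrix (Fin n) (Fin n) ℂ,
              (fun i => ∑ j, h i j • (g * ((∑ j', Kc j j' • (ψ j')ᴴ) : Matrix (Fin n) (Fin n) ℂ) * gᴴ))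
                = fun i => ∑ j, Kc i j •
                    ((∑ j', h j j' • (g * ψ j' * gᴴ) : Matrix (Fin n) (Fin n) ℂ))ᴴ)) := by
  refine ⟨?_, ?_⟩
  · intro U hU hUu hUA hUγ hUJ
    rcases Nat.eq_zero_or_pos n with rfl | hn
    · refine ⟨1, A.one_mem, by simp, by simp, 1, by simp, by simp, by simp, by simp, ?_⟩
      intro ψ
      funext i
      exact Subsingleton.elim _ _
    rcases Nat.eq_zero_or_pos k with rfl | hk
    · refine ⟨1, A.one_mem, by simp, by simp, 1, by simp, by simp, by simp, by simp, ?_⟩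
      intro ψ
      exact Subsingleton.elim _ _
    exact fz_forward n k hn hk A hAstar hAsimple hAcomm γ Kc hKc2 U hU hUu hUA hUγ hUJ
  · intro g hgA hg1 hg2 h hh1 hh2 hγ hK
    exact fz_converse n k A hAstar γ Kc g hgA hg1 hg2 h hh1 hh2 hγ hK
end

section
/- For the fuzzy sphere built from the irreducible spin-l = (n−1)/2 representation of su(2) on ℂⁿ, the spectrum of the Grosse–Presnajder operator d̃ on ℂ²⊗M(n,ℂ) is {±1, ±2, …, ±(n−1), +n}, each eigenvalue corresponding to a single irreducible representation of Spin(3) of spin j with |eigenvalue| = j + 1/2. In particular the spectrum is not symmetric about 0. -/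
open Matrix

/-- The Hilbert space ℂ²⊗M(n,ℂ), encoded as pairs of n×n matrices. -/
abbrev HGP (n : ℕ) := Fin 2 → Matrix (Fin n) (Fin n) ℂ

/-- The action of a 2×2 matrix on the spinor factor, as a linear endomorphism. -/
noncomputable def opVE (n : ℕ) (m : Matrix (Fin 2) (Fin 2) ℂ) :
    Module.End ℂ (HGP n) :=
  LinearMap.pi (fun i => ∑ j, m i j • LinearMap.proj j)

/-- The adjoint action m ↦ [X,m] on the matrix factor, as a linear endomorphism. -/
noncomputable def adLE (n : ℕ) (X : Matrix (Fin n) (Fin n) ℂ) :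
    Module.End ℂ (HGP n) :=
  LinearMap.pi (fun i =>
    (LinearMap.mulLeft ℂ X - LinearMap.mulRight ℂ X).comp (LinearMap.proj i))

/-- The set of ordered pairs j < k in {1,2,3}. -/
def pairs3 : Finset (Fin 3 × Fin 3) := Finset.univ.filter (fun p => p.1 < p.2)

/-- The Grosse–Presnajder operator d̃ = 1 + Σ_{j<k} σʲσᵏ ⊗ [L_{jk},·]. -/
noncomputable def GPop (n : ℕ) (σ : Fin 3 → Matrix (Fin 2) (Fin 2) ℂ)
    (L : Fin 3 → Fin 3 → Matrix (Fin n) (Fin n) ℂ) : Module.End ℂ (HGP n) :=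
  1 + ∑ p ∈ pairs3, (opVE n (σ p.1 * σ p.2)) * (adLE n (L p.1 p.2))

section GPaux
variable {V : Type*} [AddCommGroup V] [Module ℂ V]

theorem gp_H_pow {H F : Module.End ℂ V} (hHF : H * F - F * H = (-2 : ℂ) • F)
    {v : V} {μ : ℂ} (hv : H v = μ • v) (i : ℕ) :
    H ((F ^ i) v) = (μ - 2 * i) • (F ^ i) v := by
  induction i with
  | zero => simpa using hv
  | succ i ih =>
    have h := LinearMap.congr_fun hHF ((F ^ i) v)
    simp only [LinearMap.sub_apply, Module.End.mul_apply, LinearMap.smul_apply, ih, map_smul] at h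
    rw [pow_succ', Module.End.mul_apply, sub_eq_iff_eq_add.mp h, ← add_smul]
    congr 1
    push_cast
    ring

theorem gp_E_pow {H E F : Module.End ℂ V} (hHF : H * F - F * H = (-2 : ℂ) • F)
    (hEF : E * F - F * E = H)
    {v : V} {μ : ℂ} (hv : H v = μ • v) (hE : E v = 0) (i : ℕ) :
    E ((F ^ (i + 1)) v) = ((i + 1) * (μ - i)) • (F ^ i) v := by
  induction i with
  | zero =>
    have h := LinearMap.congr_fun hEF v
    simp only [LinearMap.sub_apply, Module.End.mul_apply, hE, map_zero, sub_zero, hv] at h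
    simpa using h
  | succ i ih =>
    have h := LinearMap.congr_fun hEF ((F ^ (i + 1)) v)
    simp only [LinearMap.sub_apply, Module.End.mul_apply, ih, map_smul,
      gp_H_pow hHF hv] at h
    rw [← Module.End.mul_apply F (F ^ i), ← pow_succ'] at h
    rw [pow_succ', Module.End.mul_apply, sub_eq_iff_eq_add.mp h, ← add_smul]
    congr 1
    push_cast
    ring

theorem gp_pow_ne {H E F : Module.End ℂ V} (hHF : H * F - F * H = (-2 : ℂ) • F)
    (hEF : E * F - F * E = H)
    {v : V} {m : ℕ} (hv0 : v ≠ 0) (hv : H v = (m : ℂ) • v) (hE : E v = 0) (i : ℕ) (hi : i ≤ m) :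
    (F ^ i) v ≠ 0 := by
  induction i with
  | zero => simpa using hv0
  | succ i ih =>
    intro h0
    have h := gp_E_pow hHF hEF hv hE i
    rw [h0, map_zero] at h
    have h1 := (smul_eq_zero.mp h.symm).resolve_right (ih (by omega))
    rcases mul_eq_zero.mp h1 with h2 | h2
    · exact Nat.cast_add_one_ne_zero i h2
    · have h3 : (m : ℂ) = (i : ℂ) := sub_eq_zero.mp h2
      have : m = i := by exact_mod_cast h3
      omega

theorem gp_lower [FiniteDimensional ℂ V] {D H E F : Module.End ℂ V}
    (hHF : H * F - F * H = (-2 : ℂ) • F)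
    (hEF : E * F - F * E = H) (hDF : D * F = F * D)
    {v : V} {m : ℕ} {z : ℂ} (hv0 : v ≠ 0) (hv : H v = (m : ℂ) • v) (hE : E v = 0)
    (hD : D v = z • v) :
    m + 1 ≤ Module.finrank ℂ (Module.End.eigenspace D z) := by
  have hmem : ∀ i : ℕ, (F ^ i) v ∈ Module.End.eigenspace D z := by
    intro i
    rw [Module.End.mem_eigenspace_iff]
    have hc : D * F ^ i = F ^ i * D := (Commute.pow_right (show Commute D F from hDF) i)
    have := LinearMap.congr_fun hc v
    simpa [hD] using this
  have hli : LinearIndependent ℂ (fun i : Fin (m + 1) => (F ^ (i : ℕ)) v) := by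
    refine Module.End.eigenvectors_linearIndependent' H
      (fun i : Fin (m + 1) => ((m : ℂ) - 2 * ((i : ℕ) : ℂ))) ?_ _ ?_
    · intro i j hij
      have h1 : ((i : ℕ) : ℂ) = ((j : ℕ) : ℂ) := by
        have := hij
        simp only at this
        linear_combination (-1 / 2 : ℂ) * this
      exact Fin.ext (by exact_mod_cast h1)
    · intro i
      rw [Module.End.hasEigenvector_iff, Module.End.mem_eigenspace_iff]
      exact ⟨gp_H_pow hHF hv i, gp_pow_ne hHF hEF hv0 hv hE i (by omega)⟩
  have hli' : LinearIndependent ℂ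
      (fun i : Fin (m + 1) => (⟨(F ^ (i : ℕ)) v, hmem i⟩ : Module.End.eigenspace D z)) :=
    LinearIndependent.of_comp (Module.End.eigenspace D z).subtype hli
  simpa using hli'.fintype_card_le_finrank

theorem gp_sum_eig [FiniteDimensional ℂ V] (D : Module.End ℂ V) (s : Finset ℂ) :
    ∑ μ ∈ s, Module.finrank ℂ (Module.End.eigenspace D μ) =
      Module.finrank ℂ (⨆ μ ∈ s, Module.End.eigenspace D μ : Submodule ℂ V) := by
  induction s using Finset.induction_on with
  | empty =>
    have : (⨆ μ ∈ (∅ : Finset ℂ), Module.End.eigenspace D μ : Submodule ℂ V) = ⊥ := by simp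
    rw [this]
    simp
  | insert a s ha ih =>
    have hd : Disjoint (Module.End.eigenspace D a) (⨆ μ ∈ s, Module.End.eigenspace D μ) :=
      D.eigenspaces_iSupIndep.disjoint_biSup (y := (s : Set ℂ)) (by simpa using ha)
    have h := Submodule.finrank_sup_add_finrank_inf_eq (Module.End.eigenspace D a)
      (⨆ μ ∈ s, Module.End.eigenspace D μ)
    rw [hd.eq_bot, finrank_bot, add_zero] at h
    rw [Finset.sum_insert ha, ih, ← h, Finset.iSup_insert]

theorem gp_sum_le [FiniteDimensional ℂ V] (D : Module.End ℂ V) (s : Finset ℂ) :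
    ∑ μ ∈ s, Module.finrank ℂ (Module.End.eigenspace D μ) ≤ Module.finrank ℂ V := by
  rw [gp_sum_eig]
  exact Submodule.finrank_le _

theorem gp_exists_prim [FiniteDimensional ℂ V] [Nontrivial V] {H E : Module.End ℂ V}
    (hHE : H * E - E * H = (2 : ℂ) • E) :
    ∃ (v : V) (μ : ℂ), v ≠ 0 ∧ H v = μ • v ∧ E v = 0 := by
  have hfin : {μ : ℂ | H.HasEigenvalue μ}.Finite := by
    have := Module.End.finite_spectrum H
    refine this.subset ?_
    intro μ hμ
    exact Module.End.hasEigenvalue_iff_mem_spectrum.mp hμ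
  obtain ⟨μ₀, hμ₀⟩ := Module.End.exists_eigenvalue H
  obtain ⟨μ, hμ, hmax⟩ := Set.exists_max_image _ (fun z : ℂ => z.re) hfin ⟨μ₀, hμ₀⟩
  obtain ⟨v, hv⟩ := Module.End.HasEigenvalue.exists_hasEigenvector hμ
  have hv1 : H v = μ • v := hv.apply_eq_smul
  refine ⟨v, μ, hv.2, hv1, ?_⟩
  by_contra hne
  have h := LinearMap.congr_fun hHE v
  simp only [LinearMap.sub_apply, Module.End.mul_apply, LinearMap.smul_apply, hv1, map_smul] at h
  have h2 : H (E v) = (2 + μ) • E v := by rw [add_smul, sub_eq_iff_eq_add.mp h]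
  have h3 : H.HasEigenvalue (2 + μ) :=
    Module.End.hasEigenvalue_of_hasEigenvector
      (Module.End.hasEigenvector_iff.mpr ⟨Module.End.mem_eigenspace_iff.mpr h2, hne⟩)
  have := hmax _ h3
  simp at this
  linarith

theorem gp_irr_pow [FiniteDimensional ℂ V] [Nontrivial V] {H E F : Module.End ℂ V}
    (hHE : H * E - E * H = (2 : ℂ) • E) (hHF : H * F - F * H = (-2 : ℂ) • F)
    (hEF : E * F - F * E = H)
    (hirr : ∀ W : Submodule ℂ V, (∀ v ∈ W, H v ∈ W) → (∀ v ∈ W, E v ∈ W) → (∀ v ∈ W, F v ∈ W) →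
      W = ⊥ ∨ W = ⊤) (k : ℕ) (hk : k < Module.finrank ℂ V) : F ^ k ≠ 0 := by
  obtain ⟨v, μ, hv0, hv, hE⟩ := gp_exists_prim hHE
  intro hF0
  set W : Submodule ℂ V := Submodule.span ℂ (Set.range fun i : Fin k => (F ^ (i : ℕ)) v) with hW
  have hmem : ∀ i : ℕ, (F ^ i) v ∈ W := by
    intro i
    by_cases hi : i < k
    · exact Submodule.subset_span ⟨⟨i, hi⟩, rfl⟩
    · rw [pow_eq_zero_of_le (not_lt.mp hi) hF0]
      simp
  have hind : ∀ T : Module.End ℂ V, (∀ i : ℕ, T ((F ^ i) v) ∈ W) → ∀ w ∈ W, T w ∈ W := by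
    intro T hT w hw
    have : W ≤ W.comap T := by
      conv_lhs => rw [hW]
      rw [Submodule.span_le]
      rintro _ ⟨i, rfl⟩
      exact hT i
    exact this hw
  have h := hirr W
    (hind _ fun i => by rw [gp_H_pow hHF hv]; exact W.smul_mem _ (hmem i))
    (hind _ fun i => by
      cases i with
      | zero => simp [hE]
      | succ i => rw [gp_E_pow hHF hEF hv hE]; exact W.smul_mem _ (hmem i))
    (hind _ fun i => by
      rw [← Module.End.mul_apply, ← pow_succ']; exact hmem _)
  rcases h with h | h
  · have := hmem 0
    rw [h] at this
    exact hv0 (by simpa using this)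
  · have h1 : Module.finrank ℂ W ≤ k := by
      rw [hW]
      simpa [Set.finrank] using finrank_range_le_card (R := ℂ) (fun i : Fin k => (F ^ (i : ℕ)) v)
    rw [h, finrank_top] at h1
    omega

end GPaux

theorem gp_sum_int (n : ℕ) :
    ∑ z ∈ Finset.Ioc (-(n : ℤ)) n, 2 * z.natAbs = 2 * n ^ 2 := by
  induction n with
  | zero => simp
  | succ n ih =>
    have : Finset.Ioc (-((n + 1 : ℕ) : ℤ)) ((n + 1 : ℕ) : ℤ) =
        insert ((n : ℤ) + 1) (insert (-(n : ℤ)) (Finset.Ioc (-(n : ℤ)) n)) := by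
      ext z
      simp only [Finset.mem_Ioc, Finset.mem_insert]
      omega
    rw [this, Finset.sum_insert, Finset.sum_insert, ih]
    · have : ((n : ℤ) + 1).natAbs = n + 1 := by omega
      rw [this, Int.natAbs_neg, Int.natAbs_natCast]
      ring
    · simp
    · simp only [Finset.mem_Ioc, Finset.mem_insert]
      omega
section GPabs
variable {V : Type*} [AddCommGroup V] [Module ℂ V]

theorem gp_abs [FiniteDimensional ℂ V] {D h e f H E F : Module.End ℂ V}
    (hhf : h * f - f * h = (-2 : ℂ) • f)
    (hef : e * f - f * e = h)
    (hHF : H * F - F * H = (-2 : ℂ) • F)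
    (hEF : E * F - F * E = H)
    (c_hF : h * F = F * h)
    (c_eF : e * F = F * e)
    (c_fH : f * H = H * f) (c_fE : f * E = E * f) (c_fF : f * F = F * f)
    (hD : D = 1 + (1 / 2 : ℂ) • (h * H) + e * F + f * E)
    {x : V} {k : ℕ} (hx0 : x ≠ 0) (hx : h x = x) (ex : e x = 0)
    (Hx : H x = (2 * k : ℂ) • x) (Ex : E x = 0) :
    2 * k + 2 ≤ Module.finrank ℂ (Module.End.eigenspace D ((k : ℂ) + 1)) ∧
    2 * k ≤ Module.finrank ℂ (Module.End.eigenspace D (-(k : ℂ))) := by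
  have hDF : D * (f + F) = (f + F) * D := by
    have e1 : h * H * f = f * (h * H) + (-2 : ℂ) • (f * H) := by
      rw [mul_assoc, ← c_fH, ← mul_assoc, sub_eq_iff_eq_add.mp hhf, add_mul, smul_mul_assoc,
        mul_assoc, add_comm]
    have e2 : h * H * F = F * (h * H) + (-2 : ℂ) • (h * F) := by
      rw [mul_assoc, sub_eq_iff_eq_add.mp hHF, mul_add, mul_smul_comm, ← mul_assoc, c_hF,
        mul_assoc, add_comm]
    have e3 : e * F * f = f * (e * F) + h * F := by
      rw [mul_assoc, ← c_fF, ← mul_assoc, sub_eq_iff_eq_add.mp hef, add_mul, mul_assoc, add_comm]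
    have e4 : e * F * F = F * (e * F) := by rw [c_eF, mul_assoc, c_eF]
    have e5 : f * E * f = f * (f * E) := by rw [mul_assoc, c_fE]
    have e6 : f * E * F = F * (f * E) + f * H := by
      rw [mul_assoc, sub_eq_iff_eq_add.mp hEF, mul_add, ← mul_assoc, c_fF, mul_assoc, add_comm]
    rw [hD]
    simp only [mul_add, add_mul, smul_mul_assoc, mul_smul_comm, one_mul, mul_one,
      e1, e2, e3, e4, e5, e6]
    module
  have tHF : (h + H) * (f + F) - (f + F) * (h + H) = (-2 : ℂ) • (f + F) := by
    simp only [mul_add, add_mul, smul_add, ← hhf, ← hHF, c_hF, c_fH]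
    abel
  have tEF : (e + E) * (f + F) - (f + F) * (e + E) = h + H := by
    rw [← hef, ← hEF]
    simp only [mul_add, add_mul, c_eF, c_fE]
    abel
  have ap : ∀ {A B : Module.End ℂ V}, A * B = B * A → ∀ v, A (B v) = B (A v) :=
    fun hc v => LinearMap.congr_fun hc v
  have hfx : h (f x) = -f x := by
    have := LinearMap.congr_fun (sub_eq_iff_eq_add.mp hhf) x
    simp only [Module.End.mul_apply, LinearMap.add_apply, LinearMap.smul_apply, hx] at this
    rw [this]; module
  have efx : e (f x) = x := by
    have := LinearMap.congr_fun (sub_eq_iff_eq_add.mp hef) x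
    simpa [hx, ex] using this
  have HFx : H (F x) = (2 * k - 2 : ℂ) • F x := by
    have := LinearMap.congr_fun (sub_eq_iff_eq_add.mp hHF) x
    simp only [Module.End.mul_apply, LinearMap.add_apply, LinearMap.smul_apply, Hx,
      map_smul] at this
    rw [this]; module
  have EFx : E (F x) = (2 * k : ℂ) • x := by
    have := LinearMap.congr_fun (sub_eq_iff_eq_add.mp hEF) x
    simpa [Hx, Ex] using this
  have Dapp : ∀ v, D v = v + (1 / 2 : ℂ) • h (H v) + e (F v) + f (E v) := by
    intro v
    rw [hD]
    simp
  constructor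
  · refine gp_lower (m := 2 * k + 1) tHF tEF hDF hx0 ?_ ?_ ?_
    · simp only [LinearMap.add_apply, hx, Hx]
      push_cast
      module
    · simp [ex, Ex]
    · rw [Dapp, Hx, map_smul, hx, ap c_eF, ex, Ex, map_zero, map_zero]
      module
  · rcases Nat.eq_zero_or_pos k with rfl | hk
    · simp
    obtain ⟨m, rfl⟩ : ∃ m, k = m + 1 := ⟨k - 1, by omega⟩
    set c : ℂ := 2 * ((m + 1 : ℕ) : ℂ) with hc
    have hc0 : c ≠ 0 := by
      rw [hc]; exact mul_ne_zero two_ne_zero (Nat.cast_ne_zero.mpr (by omega))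
    have hhFx : h (F x) = F x := by rw [ap c_hF, hx]
    have hHfx : H (f x) = c • f x := by rw [← ap c_fH, Hx, map_smul]
    have hEfx : E (f x) = 0 := by rw [← ap c_fE, Ex, map_zero]
    have heFx : e (F x) = 0 := by rw [ap c_eF, ex, map_zero]
    refine gp_lower (m := 2 * m + 1) (v := c • f x - F x) tHF tEF hDF ?_ ?_ ?_ ?_
    · intro h0
      have h1 := congrArg e h0
      rw [map_sub, map_smul, efx, heFx, sub_zero, map_zero] at h1
      exact (smul_ne_zero hc0 hx0) h1
    · simp only [LinearMap.add_apply, map_sub, map_smul, hfx, hhFx, hHfx, HFx, hc]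
      push_cast
      module
    · simp only [LinearMap.add_apply, map_sub, map_smul, efx, hEfx, heFx, EFx]
      module
    · have D1 : D (f x) = (1 - c / 2) • f x + F x := by
        rw [Dapp, hHfx, map_smul, hfx, ap c_eF, efx, hEfx, map_zero]
        module
      have D2 : D (F x) = (c / 2) • F x + c • f x := by
        rw [Dapp, HFx, map_smul, hhFx, ap c_eF, heFx, map_zero, EFx, map_smul]
        module
      have hc' : ((m + 1 : ℕ) : ℂ) = c / 2 := by rw [hc]; ring
      rw [map_sub, map_smul, D1, D2, hc']
      module
end GPabs

theorem gp_opVE_apply (n : ℕ) (m : Matrix (Fin 2) (Fin 2) ℂ) (M : HGP n) (i : Fin 2) :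
    opVE n m M i = m i 0 • M 0 + m i 1 • M 1 := by
  simp [opVE, Fin.sum_univ_two]

theorem gp_opVE_mul (n : ℕ) (a b : Matrix (Fin 2) (Fin 2) ℂ) :
    opVE n (a * b) = opVE n a * opVE n b := by
  refine LinearMap.ext fun M => funext fun i => ?_
  simp only [Module.End.mul_apply, gp_opVE_apply, Matrix.mul_apply, Fin.sum_univ_two]
  module

theorem gp_opVE_add (n : ℕ) (a b : Matrix (Fin 2) (Fin 2) ℂ) :
    opVE n (a + b) = opVE n a + opVE n b := by
  refine LinearMap.ext fun M => funext fun i => ?_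
  simp only [LinearMap.add_apply, Pi.add_apply, gp_opVE_apply, Matrix.add_apply]
  module

theorem gp_opVE_smul (n : ℕ) (c : ℂ) (a : Matrix (Fin 2) (Fin 2) ℂ) :
    opVE n (c • a) = c • opVE n a := by
  refine LinearMap.ext fun M => funext fun i => ?_
  simp only [LinearMap.smul_apply, Pi.smul_apply, gp_opVE_apply, Matrix.smul_apply, smul_eq_mul]
  module

theorem gp_opVE_sub (n : ℕ) (a b : Matrix (Fin 2) (Fin 2) ℂ) :
    opVE n (a - b) = opVE n a - opVE n b := by
  have := gp_opVE_add n (a - b) b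
  rw [sub_add_cancel] at this
  rw [this, add_sub_cancel_right]

theorem gp_adLE_apply (n : ℕ) (X : Matrix (Fin n) (Fin n) ℂ) (M : HGP n) (i : Fin 2) :
    adLE n X M i = X * M i - M i * X := by
  simp [adLE]

theorem gp_adLE_add (n : ℕ) (X Y : Matrix (Fin n) (Fin n) ℂ) :
    adLE n (X + Y) = adLE n X + adLE n Y := by
  refine LinearMap.ext fun M => funext fun i => ?_
  simp only [LinearMap.add_apply, Pi.add_apply, gp_adLE_apply]
  noncomm_ring

theorem gp_adLE_smul (n : ℕ) (c : ℂ) (X : Matrix (Fin n) (Fin n) ℂ) :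
    adLE n (c • X) = c • adLE n X := by
  refine LinearMap.ext fun M => funext fun i => ?_
  simp only [LinearMap.smul_apply, Pi.smul_apply, gp_adLE_apply, smul_mul_assoc, mul_smul_comm,
    smul_sub]

theorem gp_adLE_sub (n : ℕ) (X Y : Matrix (Fin n) (Fin n) ℂ) :
    adLE n (X - Y) = adLE n X - adLE n Y := by
  have := gp_adLE_add n (X - Y) Y
  rw [sub_add_cancel] at this
  rw [this, add_sub_cancel_right]

theorem gp_adLE_comm (n : ℕ) (X Y : Matrix (Fin n) (Fin n) ℂ) :
    adLE n (X * Y - Y * X) = adLE n X * adLE n Y - adLE n Y * adLE n X := by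
  refine LinearMap.ext fun M => funext fun i => ?_
  simp only [LinearMap.sub_apply, Pi.sub_apply, Module.End.mul_apply, gp_adLE_apply]
  noncomm_ring

theorem gp_op_ad_comm (n : ℕ) (a : Matrix (Fin 2) (Fin 2) ℂ) (X : Matrix (Fin n) (Fin n) ℂ) :
    opVE n a * adLE n X = adLE n X * opVE n a := by
  refine LinearMap.ext fun M => funext fun i => ?_
  simp only [Module.End.mul_apply, gp_adLE_apply, gp_opVE_apply,
    mul_add, add_mul, mul_smul_comm, smul_mul_assoc, smul_sub]
  abel

section GPalg
variable {R : Type*} [Ring R] [Algebra ℂ R]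
open Complex

theorem gp_so3_HE {A B C : R} (hAB : A * B - B * A = C) (hCA : C * A - A * C = B) :
    ((2 * I) • A) * (I • B - C) - (I • B - C) * ((2 * I) • A) = (2 : ℂ) • (I • B - C) := by
  have h1 : A * B = B * A + C := by rw [← hAB]; abel
  have h2 : C * A = A * C + B := by rw [← hCA]; abel
  simp only [mul_sub, sub_mul, smul_mul_assoc, mul_smul_comm, h1, h2]
  match_scalars <;>
    first
    | ring1
    | linear_combination (2 : ℂ) * I_mul_I
    | linear_combination (-2 : ℂ) * I_mul_I

theorem gp_so3_HF {A B C : R} (hAB : A * B - B * A = C) (hCA : C * A - A * C = B) :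
    ((2 * I) • A) * (I • B + C) - (I • B + C) * ((2 * I) • A) = (-2 : ℂ) • (I • B + C) := by
  have h1 : A * B = B * A + C := by rw [← hAB]; abel
  have h2 : C * A = A * C + B := by rw [← hCA]; abel
  simp only [mul_add, add_mul, smul_mul_assoc, mul_smul_comm, h1, h2]
  match_scalars <;>
    first
    | ring1
    | linear_combination (2 : ℂ) * I_mul_I
    | linear_combination (-2 : ℂ) * I_mul_I

theorem gp_so3_EF {A B C : R} (hBC : B * C - C * B = A) :
    (I • B - C) * (I • B + C) - (I • B + C) * (I • B - C) = (2 * I) • A := by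
  rw [← hBC]
  simp only [mul_add, add_mul, mul_sub, sub_mul, smul_mul_assoc, mul_smul_comm, smul_sub]
  module

theorem gp_spin {s0 s1 s2 : R} (h00 : s0 * s0 = -1) (h11 : s1 * s1 = -1) (h22 : s2 * s2 = -1)
    (h10 : s1 * s0 = -(s0 * s1)) (h20 : s2 * s0 = -(s0 * s2)) (h21 : s2 * s1 = -(s1 * s2)) :
    (s0 * s1) * (s1 * s2) = -(s0 * s2) ∧ (s1 * s2) * (s0 * s1) = s0 * s2 ∧
    (s1 * s2) * (s0 * s2) = -(s0 * s1) ∧ (s0 * s2) * (s1 * s2) = s0 * s1 ∧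
    (s0 * s2) * (s0 * s1) = -(s1 * s2) ∧ (s0 * s1) * (s0 * s2) = s1 * s2 ∧
    (s0 * s1) * (s0 * s1) = -1 ∧ (s1 * s2) * (s1 * s2) = -1 ∧ (s0 * s2) * (s0 * s2) = -1 := by
  have k00 : ∀ x, s0 * (s0 * x) = -x := fun x => by rw [← mul_assoc, h00]; simp
  have k11 : ∀ x, s1 * (s1 * x) = -x := fun x => by rw [← mul_assoc, h11]; simp
  have k22 : ∀ x, s2 * (s2 * x) = -x := fun x => by rw [← mul_assoc, h22]; simp
  have k10 : ∀ x, s1 * (s0 * x) = -(s0 * (s1 * x)) := fun x => by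
    rw [← mul_assoc, h10]; simp [mul_assoc]
  have k20 : ∀ x, s2 * (s0 * x) = -(s0 * (s2 * x)) := fun x => by
    rw [← mul_assoc, h20]; simp [mul_assoc]
  have k21 : ∀ x, s2 * (s1 * x) = -(s1 * (s2 * x)) := fun x => by
    rw [← mul_assoc, h21]; simp [mul_assoc]
  refine ⟨?_, ?_, ?_, ?_, ?_, ?_, ?_, ?_, ?_⟩ <;>
    simp [mul_assoc, k00, k11, k22, k10, k20, k21, h00, h11, h22, h10, h20, h21]

/-- With a = -½ s0 s1 etc. -/
theorem gp_spin2 {p q r : R} (pq : p * q = -r) (qp : q * p = r) (qr : q * r = -p)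
    (rq : r * q = p) (rp : r * p = -q) (pr : p * r = q) (qq : q * q = -1) (rr : r * r = -1)
    {a b c : R} (ha : a = (-1 / 2 : ℂ) • p) (hb : b = (-1 / 2 : ℂ) • q)
    (hc : c = (-1 / 2 : ℂ) • r) :
    (a * b - b * a = c ∧ b * c - c * b = a ∧ c * a - a * c = b) ∧
    ((2 * I) • a) * (I • b - c) = I • b - c ∧ (I • b - c) * (I • b - c) = 0 := by
  subst ha hb hc
  refine ⟨⟨?_, ?_, ?_⟩, ?_, ?_⟩
  · simp only [smul_mul_assoc, mul_smul_comm, pq, qp]; module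
  · simp only [smul_mul_assoc, mul_smul_comm, qr, rq]; module
  · simp only [smul_mul_assoc, mul_smul_comm, pr, rp]; module
  · simp only [mul_sub, smul_mul_assoc, mul_smul_comm, pq, pr, smul_smul]
    have e1 : (2 * I * (I * (-1 / 2 * (-1 / 2))) : ℂ) = -1 / 2 := by
      linear_combination (1 / 2 : ℂ) * I_mul_I
    have e2 : (2 * I * (-1 / 2 * (-1 / 2)) : ℂ) = I / 2 := by ring
    match_scalars
    · linear_combination (-1 / 2 : ℂ) * I_mul_I
    · ring
  · simp only [mul_sub, sub_mul, smul_mul_assoc, mul_smul_comm, qr, rq, qq, rr, smul_smul]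
    match_scalars
    · linear_combination (-1 / 4 : ℂ) * I_mul_I
    · ring

theorem gp_H_Epow {H E : R} (hHE : H * E - E * H = (2 : ℂ) • E) (k : ℕ) :
    H * E ^ k - E ^ k * H = (2 * k : ℂ) • E ^ k := by
  induction k with
  | zero => simp
  | succ k ih =>
    have : H * E ^ (k + 1) - E ^ (k + 1) * H =
        (H * E ^ k - E ^ k * H) * E + E ^ k * (H * E - E * H) := by
      rw [pow_succ]; noncomm_ring
    rw [this, ih, hHE, smul_mul_assoc, mul_smul_comm, ← pow_succ]
    push_cast
    module
end GPalg

open Complex in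
theorem gp_main_lower (n : ℕ) (hn : 0 < n)
    (σ : Fin 3 → Matrix (Fin 2) (Fin 2) ℂ)
    (hσ : ∀ j k, σ j * σ k + σ k * σ j =
      if j = k then (-2 : ℂ) • (1 : Matrix (Fin 2) (Fin 2) ℂ) else 0)
    (L : Fin 3 → Fin 3 → Matrix (Fin n) (Fin n) ℂ)
    (hLanti : ∀ j k, L j k = -L k j)
    (hLrel : ∀ j k l m, L j k * L l m - L l m * L j k =
      (if k = l then (1:ℂ) else 0) • L j m - (if k = m then (1:ℂ) else 0) • L j l
        - (if j = l then (1:ℂ) else 0) • L k m + (if j = m then (1:ℂ) else 0) • L k l)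
    (hLirr : ∀ W : Submodule ℂ (Fin n → ℂ),
      (∀ j k, ∀ v ∈ W, (L j k).mulVec v ∈ W) → W = ⊥ ∨ W = ⊤) (k : ℕ) (hk : k < n) :
    2 * k + 2 ≤ Module.finrank ℂ (Module.End.eigenspace (GPop n σ L) ((k : ℂ) + 1)) ∧
    2 * k ≤ Module.finrank ℂ (Module.End.eigenspace (GPop n σ L) (-(k : ℂ))) := by
  -- the rotation generators
  have hAB : L 0 1 * L 1 2 - L 1 2 * L 0 1 = L 0 2 := by simpa using hLrel 0 1 1 2
  have hBC : L 1 2 * L 0 2 - L 0 2 * L 1 2 = L 0 1 := by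
    have := hLrel 1 2 0 2
    rw [hLanti 1 0] at this
    simpa using this
  have hCA : L 0 2 * L 0 1 - L 0 1 * L 0 2 = L 1 2 := by
    have := hLrel 0 2 0 1
    rw [hLanti 2 1] at this
    simpa using this
  have hdiag : ∀ j, L j j = 0 := by
    intro j
    have h2 : L j j + L j j = 0 := by
      nth_rewrite 1 [hLanti]
      simp
    have : L j j = (1 / 2 : ℂ) • (L j j + L j j) := by module
    rw [this, h2, smul_zero]
  generalize hA : L 0 1 = A at *
  generalize hB : L 1 2 = B at *
  generalize hC : L 0 2 = C at *
  have HE := gp_so3_HE hAB hCA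
  have HF := gp_so3_HF hAB hCA
  have EF := gp_so3_EF hBC
  have hI2 : I * I = -1 := I_mul_I
  -- nilpotency order
  have hEk : (I • B - C) ^ k ≠ 0 := by
    have : Nonempty (Fin n) := ⟨⟨0, hn⟩⟩
    let φ := (Matrix.toLinAlgEquiv' : Matrix (Fin n) (Fin n) ℂ ≃ₐ[ℂ] _)
    have key := gp_irr_pow (V := Fin n → ℂ) (H := φ (-((2 * I) • A))) (E := φ (I • B + C))
      (F := φ (I • B - C)) ?_ ?_ ?_ ?_ k (by simpa using hk)
    · intro h0
      apply key
      rw [← map_pow, h0, map_zero]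
    · rw [← map_mul, ← map_mul, ← map_sub, ← map_smul]
      congr 1
      rw [neg_mul, mul_neg, sub_neg_eq_add, neg_add_eq_sub, ← neg_sub, HF]
      module
    · rw [← map_mul, ← map_mul, ← map_sub, ← map_smul]
      congr 1
      rw [neg_mul, mul_neg, sub_neg_eq_add, neg_add_eq_sub, ← neg_sub, HE]
      module
    · rw [← map_mul, ← map_mul, ← map_sub]
      congr 1
      rw [← EF, neg_sub]
    · intro W hWH hWF hWE
      have ap : ∀ (M : Matrix (Fin n) (Fin n) ℂ) v, φ M v = M.mulVec v := fun M v => rfl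
      have hAW : ∀ v ∈ W, A.mulVec v ∈ W := by
        intro v hv
        have h := W.smul_mem (I / 2) (hWH v hv)
        rw [← LinearMap.smul_apply, ← map_smul] at h
        have e : (I / 2) • -((2 * I) • A) = A := by
          match_scalars
          linear_combination -hI2
        rwa [e] at h
      have hBW : ∀ v ∈ W, B.mulVec v ∈ W := by
        intro v hv
        have h := W.smul_mem (-I / 2) (W.add_mem (hWE v hv) (hWF v hv))
        rw [← LinearMap.add_apply, ← map_add, ← LinearMap.smul_apply, ← map_smul] at h
        have e : (-I / 2) • (I • B - C + (I • B + C)) = B := by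
          match_scalars
          · linear_combination -hI2
          · ring
        rwa [e] at h
      have hCW : ∀ v ∈ W, C.mulVec v ∈ W := by
        intro v hv
        have h := W.smul_mem (1 / 2 : ℂ) (W.sub_mem (hWF v hv) (hWE v hv))
        rw [← LinearMap.sub_apply, ← map_sub, ← LinearMap.smul_apply, ← map_smul] at h
        have e : (1 / 2 : ℂ) • (I • B + C - (I • B - C)) = C := by
          module
        rwa [e] at h
      have hneg : ∀ M : Matrix (Fin n) (Fin n) ℂ, (∀ v ∈ W, M.mulVec v ∈ W) →
          ∀ v ∈ W, (-M).mulVec v ∈ W := by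
        intro M hM v hv
        rw [Matrix.neg_mulVec]
        exact W.neg_mem (hM v hv)
      apply hLirr W
      have h10 : L 1 0 = -A := by rw [hLanti, hA]
      have h21 : L 2 1 = -B := by rw [hLanti, hB]
      have h20 : L 2 0 = -C := by rw [hLanti, hC]
      have h0 : ∀ j, ∀ v ∈ W, (L j j).mulVec v ∈ W := by
        intro j v _
        rw [hdiag]; simp
      intro j l
      fin_cases j <;> fin_cases l
      · exact h0 0
      · simpa [hA] using hAW
      · simpa [hC] using hCW
      · simpa [h10] using hneg A hAW
      · exact h0 1
      · simpa [hB] using hBW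
      · simpa [h20] using hneg C hCW
      · simpa [h21] using hneg B hBW
      · exact h0 2
  -- spin part
  have sq : ∀ j, σ j * σ j = -1 := by
    intro j
    have h := hσ j j
    rw [if_pos rfl] at h
    have : σ j * σ j = (1 / 2 : ℂ) • (σ j * σ j + σ j * σ j) := by module
    rw [this, h]; module
  have ac : ∀ j l, j ≠ l → σ j * σ l = -(σ l * σ j) := by
    intro j l hjl
    have h := hσ j l
    rw [if_neg hjl] at h
    exact eq_neg_of_add_eq_zero_left h
  obtain ⟨pq, qp, qr, rq, rp, pr, pp, qq, rr⟩ := gp_spin (sq 0) (sq 1) (sq 2)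
    (ac 1 0 (by decide)) (ac 2 0 (by decide)) (ac 2 1 (by decide))
  generalize hp : σ 0 * σ 1 = p at *
  generalize hq : σ 1 * σ 2 = q at *
  generalize hr : σ 0 * σ 2 = r at *
  obtain ⟨a, ha⟩ : ∃ a, a = (-1 / 2 : ℂ) • p := ⟨_, rfl⟩
  obtain ⟨b, hb⟩ : ∃ b, b = (-1 / 2 : ℂ) • q := ⟨_, rfl⟩
  obtain ⟨c, hc⟩ : ∃ c, c = (-1 / 2 : ℂ) • r := ⟨_, rfl⟩
  obtain ⟨⟨hab, hbc, hca⟩, hhe, hee⟩ := gp_spin2 pq qp qr rq rp pr qq rr ha hb hc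
  have shf := gp_so3_HF hab hca
  have sef := gp_so3_EF hbc
  have he0 : I • b - c ≠ 0 := by
    intro h0
    rw [h0, zero_mul, mul_zero, sub_zero] at sef
    have ha0 : a = 0 := (smul_eq_zero.mp sef.symm).resolve_left (by simp)
    have hp0 : p = 0 := by
      have : p = (-2 : ℂ) • a := by rw [ha]; module
      rw [this, ha0, smul_zero]
    rw [hp0, mul_zero] at pp
    have := congrFun (congrFun pp 0) 0
    simp at this
  have hD : GPop n σ L = 1 + (1 / 2 : ℂ) • (opVE n ((2 * I) • a) * adLE n ((2 * I) • A))
      + opVE n (I • b - c) * adLE n (I • B + C) + opVE n (I • b + c) * adLE n (I • B - C) := by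
    have hP : pairs3 = {(0, 1), (0, 2), (1, 2)} := by decide
    have hsum : GPop n σ L = 1 + (opVE n p * adLE n A + opVE n r * adLE n C +
        opVE n q * adLE n B) := by
      rw [GPop, hP, Finset.sum_insert (by decide), Finset.sum_insert (by decide),
        Finset.sum_singleton]
      simp only [hp, hq, hr, hA, hB, hC]
      rw [add_assoc]
    rw [hsum, ha, hb, hc]
    simp only [gp_opVE_add, gp_opVE_sub, gp_opVE_smul, gp_adLE_add, gp_adLE_sub, gp_adLE_smul,
      mul_add, add_mul, mul_sub, sub_mul, smul_mul_assoc, mul_smul_comm, smul_smul]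
    match_scalars <;>
      first
      | ring1
      | linear_combination hI2
      | linear_combination -hI2
      | linear_combination (1 / 2 : ℂ) * hI2
      | linear_combination (-1 / 2 : ℂ) * hI2
  -- the highest weight vector
  obtain ⟨i₀, j₀, hij⟩ : ∃ i j, (I • b - c) i j ≠ 0 := by
    by_contra hcon
    push Not at hcon
    exact he0 (Matrix.ext fun i j => by simpa using hcon i j)
  generalize hee' : I • b - c = e at *
  generalize hEE' : I • B - C = E at *
  generalize hHH' : (2 * I) • A = H at *
  generalize hhh' : (2 * I) • a = h at *
  have opx : ∀ m : Matrix (Fin 2) (Fin 2) ℂ,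
      opVE n m (fun i => e i j₀ • E ^ k) = fun i => (m * e) i j₀ • E ^ k := by
    intro m
    funext i
    rw [gp_opVE_apply, Matrix.mul_apply, Fin.sum_univ_two]
    module
  refine gp_abs (x := fun i => e i j₀ • E ^ k) (k := k)
    (h := opVE n h) (e := opVE n e) (f := opVE n (I • b + c))
    (H := adLE n H) (E := adLE n E) (F := adLE n (I • B + C))
    ?_ ?_ ?_ ?_ (gp_op_ad_comm _ _ _) (gp_op_ad_comm _ _ _) (gp_op_ad_comm _ _ _)
    (gp_op_ad_comm _ _ _) (gp_op_ad_comm _ _ _) hD ?_ ?_ ?_ ?_ ?_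
  · rw [← gp_opVE_mul, ← gp_opVE_mul, ← gp_opVE_sub, shf, gp_opVE_smul]
  · rw [← gp_opVE_mul, ← gp_opVE_mul, ← gp_opVE_sub, sef]
  · rw [← gp_adLE_comm, HF, gp_adLE_smul]
  · rw [← gp_adLE_comm, EF]
  · intro h0
    have := congrFun h0 i₀
    exact (smul_ne_zero hij hEk) this
  · rw [opx, hhe]
  · rw [opx, hee]
    funext i
    simp
  · funext i
    rw [gp_adLE_apply, mul_smul_comm, smul_mul_assoc, ← smul_sub, gp_H_Epow HE, Pi.smul_apply,
      smul_comm]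
  · funext i
    rw [gp_adLE_apply, mul_smul_comm, smul_mul_assoc, ← smul_sub, ← pow_succ, ← pow_succ',
      sub_self, smul_zero]
    rfl

/-- For the fuzzy sphere built on the n-dimensional irreducible
representation of su(2), the spectrum of the Grosse–Presnajder operator is
{±1, ±2, …, ±(n−1), +n}, each eigenvalue λ corresponding to a single
irreducible representation of Spin(3) of spin j = |λ| − 1/2 (so the eigenspace
has dimension 2|λ|).  In particular the spectrum is not symmetric about 0. -/
theorem grosse_presnajder_spectrum
    (n : ℕ) (hn : 0 < n)
    (σ : Fin 3 → Matrix (Fin 2) (Fin 2) ℂ)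
    (hσ : ∀ j k, σ j * σ k + σ k * σ j =
      if j = k then (-2 : ℂ) • (1 : Matrix (Fin 2) (Fin 2) ℂ) else 0)
    (L : Fin 3 → Fin 3 → Matrix (Fin n) (Fin n) ℂ)
    (hLanti : ∀ j k, L j k = -L k j)
    (hLskew : ∀ j k, (L j k)ᴴ = -(L j k))
    (hLrel : ∀ j k l m, L j k * L l m - L l m * L j k =
      (if k = l then (1:ℂ) else 0) • L j m - (if k = m then (1:ℂ) else 0) • L j l
        - (if j = l then (1:ℂ) else 0) • L k m + (if j = m then (1:ℂ) else 0) • L k l)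
    (hLirr : ∀ W : Submodule ℂ (Fin n → ℂ),
      (∀ j k, ∀ v ∈ W, (L j k).mulVec v ∈ W) → W = ⊥ ∨ W = ⊤) :
    -- the spectrum is exactly {±1, …, ±(n−1), +n}
    (∀ μ : ℂ, Module.End.HasEigenvalue (GPop n σ L) μ ↔
      ∃ z : ℤ, μ = (z : ℂ) ∧ 1 ≤ |z| ∧ |z| ≤ (n : ℤ) ∧ z ≠ -(n : ℤ))
    -- each eigenvalue z corresponds to a single irreducible of spin |z| − 1/2
    ∧ (∀ z : ℤ, 1 ≤ |z| → |z| ≤ (n : ℤ) → z ≠ -(n : ℤ) →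
        Module.finrank ℂ
          ↥(Module.End.eigenspace (GPop n σ L) (z : ℂ)) = 2 * z.natAbs)
    -- the spectrum is not symmetric about 0
    ∧ Module.End.HasEigenvalue (GPop n σ L) (n : ℂ)
    ∧ ¬ Module.End.HasEigenvalue (GPop n σ L) (-(n : ℂ)) := by

  have hlow := gp_main_lower n hn σ hσ L hLanti hLrel hLirr
  generalize GPop n σ L = D at hlow ⊢
  have hdim : Module.finrank ℂ (HGP n) = 2 * n ^ 2 := by
    simp [Module.finrank_pi_fintype, Module.finrank_matrix]
    ring
  have hle : ∀ z ∈ Finset.Ioc (-(n : ℤ)) n, 2 * z.natAbs ≤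
      Module.finrank ℂ (Module.End.eigenspace D (z : ℂ)) := by
    intro z hz
    rw [Finset.mem_Ioc] at hz
    rcases lt_or_ge 0 z with h | h
    · obtain ⟨k, rfl⟩ : ∃ k : ℕ, z = k + 1 := ⟨(z - 1).toNat, by omega⟩
      have := (hlow k (by omega)).1
      have e : (((k : ℤ) + 1 : ℤ) : ℂ) = (k : ℂ) + 1 := by push_cast; rfl
      rw [e]
      omega
    · obtain ⟨k, rfl⟩ : ∃ k : ℕ, z = -(k : ℤ) := ⟨(-z).toNat, by omega⟩
      have := (hlow k (by omega)).2
      have e : ((-(k : ℤ) : ℤ) : ℂ) = -(k : ℂ) := by push_cast; rfl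
      rw [e]
      omega
  have hinj : Set.InjOn (fun z : ℤ => (z : ℂ)) (Finset.Ioc (-(n : ℤ)) n : Set ℤ) :=
    fun x _ y _ hxy => Int.cast_injective hxy
  set S : Finset ℂ := (Finset.Ioc (-(n : ℤ)) n).image (fun z : ℤ => (z : ℂ)) with hS
  have hSsum : ∑ μ ∈ S, Module.finrank ℂ (Module.End.eigenspace D μ) =
      ∑ z ∈ Finset.Ioc (-(n : ℤ)) n, Module.finrank ℂ (Module.End.eigenspace D (z : ℂ)) := by
    rw [hS, Finset.sum_image hinj]
  have hge : 2 * n ^ 2 ≤ ∑ μ ∈ S, Module.finrank ℂ (Module.End.eigenspace D μ) := by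
    rw [hSsum, ← gp_sum_int]
    exact Finset.sum_le_sum hle
  have hupp := gp_sum_le D S
  have heq : ∀ z ∈ Finset.Ioc (-(n : ℤ)) n,
      Module.finrank ℂ (Module.End.eigenspace D (z : ℂ)) = 2 * z.natAbs := by
    have h1 : ∑ z ∈ Finset.Ioc (-(n : ℤ)) n, 2 * z.natAbs =
        ∑ z ∈ Finset.Ioc (-(n : ℤ)) n, Module.finrank ℂ (Module.End.eigenspace D (z : ℂ)) := by
      rw [gp_sum_int, ← hSsum]
      omega
    intro z hz
    exact ((Finset.sum_eq_sum_iff_of_le hle).mp h1 z hz).symm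
  have hother : ∀ μ : ℂ, μ ∉ S → Module.finrank ℂ (Module.End.eigenspace D μ) = 0 := by
    intro μ hμ
    have h1 := gp_sum_le D (insert μ S)
    rw [Finset.sum_insert hμ] at h1
    omega
  have hiff : ∀ μ : ℂ, Module.End.HasEigenvalue D μ ↔
      Module.finrank ℂ (Module.End.eigenspace D μ) ≠ 0 := by
    intro μ
    rw [Module.End.hasEigenvalue_iff, ne_eq, ne_eq, Submodule.finrank_eq_zero]
  have hspec : ∀ μ : ℂ, Module.End.HasEigenvalue D μ ↔
      ∃ z : ℤ, μ = (z : ℂ) ∧ 1 ≤ |z| ∧ |z| ≤ (n : ℤ) ∧ z ≠ -(n : ℤ) := by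
    intro μ
    rw [hiff]
    constructor
    · intro hne
      have hμ : μ ∈ S := by
        by_contra hcon
        exact hne (hother μ hcon)
      rw [hS, Finset.mem_image] at hμ
      obtain ⟨z, hz, rfl⟩ := hμ
      simp only [heq z hz] at hne
      rw [Finset.mem_Ioc] at hz
      refine ⟨z, rfl, ?_⟩
      rw [Int.abs_eq_natAbs]
      refine ⟨?_, ?_, ?_⟩ <;> omega
    · rintro ⟨z, rfl, h1, h2, h3⟩
      rw [Int.abs_eq_natAbs] at h1 h2
      rw [heq z (by rw [Finset.mem_Ioc]; omega)]
      omega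
  refine ⟨hspec, ?_, ?_, ?_⟩
  · intro z h1 h2 h3
    rw [Int.abs_eq_natAbs] at h1 h2
    exact heq z (by rw [Finset.mem_Ioc]; omega)
  · rw [hspec]
    refine ⟨n, by simp, ?_⟩
    rw [Int.abs_eq_natAbs]
    refine ⟨?_, ?_, ?_⟩ <;> omega
  · rw [hspec]
    rintro ⟨z, hz, _, _, h3⟩
    apply h3
    have : ((-(n : ℤ) : ℤ) : ℂ) = (z : ℂ) := by rw [← hz]; simp
    exact (by exact_mod_cast this.symm)
end
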